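/- For every n ≥ 1, q·F_n^I(x,y,q)² − F_{n+1}^I(x,y,q)·F_{n−1}^I(x,y,q) = (−1)^n y^n q^{(n−1)²}, as an identity in ℤ[x,y,q] (a Cassini-like identity for the q-Fibonacci polynomials F_n^I). -/

import Mathlib

open Finset MvPolynomial

open scoped Classical

/-- `σ` (a permutation of `[n]` in one-line notation `σ 0, …, σ (n-1)`) contains the
pattern `π` (given by its one-line notation as a function `Fin m → Fin m`) if some
subsequence of `σ` is order isomorphic to `π`. -/
def PermContains {n m : ℕ} (σ : Equiv.Perm (Fin n)) (π : Fin m → Fin m) : Prop :=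
  ∃ f : Fin m → Fin n, (∀ a b : Fin m, a < b → f a < f b) ∧
    ∀ a b : Fin m, σ (f a) < σ (f b) ↔ π a < π b

/-- `σ` avoids the pattern `π`. -/
def PermAvoids {n m : ℕ} (σ : Equiv.Perm (Fin n)) (π : Fin m → Fin m) : Prop :=
  ¬ PermContains σ π

/-- The value `σ i` of the one-line notation of `σ`, as a natural number (0-based). -/
def permVal {n : ℕ} (σ : Equiv.Perm (Fin n)) (i : ℕ) : ℕ :=
  if h : i < n then (σ ⟨i, h⟩ : ℕ) else 0

/-- `inv σ` : the number of inversions, i.e. pairs of positions `i < j` with `σ i > σ j`. -/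
def invStat {n : ℕ} (σ : Equiv.Perm (Fin n)) : ℕ :=
  ((Finset.range n ×ˢ Finset.range n).filter
    fun p => p.1 < p.2 ∧ permVal σ p.2 < permVal σ p.1).card

/-- `maj σ` : the sum of all (1-based) indices `i` with `σ(i) > σ(i+1)`; with 0-based
positions, a descent at positions `i, i+1` contributes `i + 1`. -/
def majStat {n : ℕ} (σ : Equiv.Perm (Fin n)) : ℕ :=
  ∑ i ∈ Finset.range (n - 1), if permVal σ (i + 1) < permVal σ i then i + 1 else 0

/-- The number of ascents of `σ`; for `σ ∈ Sₙ(123,132,213)` (a reverse layered matching)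
this equals `d σ`, the number of doubleton blocks. -/
def ascStat {n : ℕ} (σ : Equiv.Perm (Fin n)) : ℕ :=
  ((Finset.range (n - 1)).filter fun i => permVal σ i < permVal σ (i + 1)).card

/-- The number of descents of `σ`; for `σ ∈ Sₙ(231,312,321)` (a layered matching)
this equals `d σ`, the number of doubleton blocks. -/
def descStat {n : ℕ} (σ : Equiv.Perm (Fin n)) : ℕ :=
  ((Finset.range (n - 1)).filter fun i => permVal σ (i + 1) < permVal σ i).card

/-- `Sₙ(123, 132, 213)` : permutations of `[n]` avoiding `123`, `132` and `213`
(patterns written 0-based). -/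
noncomputable def S123 (n : ℕ) : Finset (Equiv.Perm (Fin n)) :=
  Finset.univ.filter fun σ =>
    PermAvoids σ ![0, 1, 2] ∧ PermAvoids σ ![0, 2, 1] ∧ PermAvoids σ ![1, 0, 2]

/-- `Sₙ(231, 312, 321)` : permutations of `[n]` avoiding `231`, `312` and `321`
(patterns written 0-based). -/
noncomputable def S231 (n : ℕ) : Finset (Equiv.Perm (Fin n)) :=
  Finset.univ.filter fun σ =>
    PermAvoids σ ![1, 2, 0] ∧ PermAvoids σ ![2, 0, 1] ∧ PermAvoids σ ![2, 1, 0]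

/-- `Fₙᴵ(x, y, q) = Σ_{σ ∈ Sₙ(123,132,213)} x^(s σ) * y^(d σ) * q^(inv σ)` in `ℤ[x,y,q]`,
where `d σ = ascStat σ` is the number of doubletons and `s σ = n - 2 * d σ` the number of
singletons; here `x = X 0`, `y = X 1`, `q = X 2`. -/
noncomputable def FI (n : ℕ) : MvPolynomial (Fin 3) ℤ :=
  ∑ σ ∈ S123 n, X 0 ^ (n - 2 * ascStat σ) * X 1 ^ ascStat σ * X 2 ^ invStat σ

theorem permVal_lt {n : ℕ} (σ : Equiv.Perm (Fin n)) {i : ℕ} (hi : i < n) : permVal σ i < n := by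
  simp [permVal, hi]

theorem permVal_coe {n : ℕ} (σ : Equiv.Perm (Fin n)) (i : Fin n) : permVal σ i = σ i := by
  simp [permVal]

theorem perm_ext_of_permVal {n : ℕ} {σ τ : Equiv.Perm (Fin n)}
    (h : ∀ i < n, permVal σ i = permVal τ i) : σ = τ := by
  ext i
  rw [← permVal_coe, ← permVal_coe, h i i.isLt]

/-- A permutation avoids `123`, `132` and `213` exactly when any two entries at distance at
least two are inverted. -/
theorem mem_S123_iff {n : ℕ} (σ : Equiv.Perm (Fin n)) :
    σ ∈ S123 n ↔ ∀ i k : ℕ, i + 2 ≤ k → k < n → permVal σ k < permVal σ i := by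
  have hne : ∀ {a b : Fin n}, a < b → σ a ≠ σ b := fun h e => h.ne (σ.injective e)
  have key : σ ∈ S123 n ↔ ∀ i j k : Fin n, i < j → j < k → σ k < σ i := by
    simp only [S123, mem_filter, mem_univ, true_and, PermAvoids, PermContains, not_exists, not_and]
    constructor
    · rintro ⟨h1, h2, h3⟩ i j k hij hjk
      have hmono : ∀ a b : Fin 3, a < b → ![i, j, k] a < ![i, j, k] b := by
        intro a b hab
        fin_cases a <;> fin_cases b <;> simp_all
        exact hij.trans hjk
      by_contra hlt
      have hij' := hne hij
      have hjk' := hne hjk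
      have hik' := hne (hij.trans hjk)
      rcases lt_or_gt_of_ne hij' with h | h
      · rcases lt_or_gt_of_ne hjk' with h' | h'
        · refine h1 _ hmono fun a b => ?_
          fin_cases a <;> fin_cases b <;> simp <;> order
        · refine h2 _ hmono fun a b => ?_
          fin_cases a <;> fin_cases b <;> simp <;> order
      · refine h3 _ hmono fun a b => ?_
        fin_cases a <;> fin_cases b <;> simp <;> order
    · intro h
      refine ⟨fun f hf hfπ => ?_, fun f hf hfπ => ?_, fun f hf hfπ => ?_⟩ <;>
      · have h1 := h _ _ _ (hf 0 1 (by decide)) (hf 1 2 (by decide))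
        have h2 := (hfπ 0 2).2 (by decide)
        exact lt_asymm h1 h2
  rw [key]
  constructor
  · intro h i k hik hk
    have := h ⟨i, by omega⟩ ⟨i + 1, by omega⟩ ⟨k, hk⟩ (by simp) (by simp; omega)
    simpa [permVal, hk, show i < n by omega] using this
  · intro h i j k hij hjk
    have := h i k (by omega) k.isLt
    rwa [permVal_coe, permVal_coe] at this

/-- Prepend a new maximum to the one-line notation of `σ`. -/
def consMax {n : ℕ} (σ : Equiv.Perm (Fin n)) : Equiv.Perm (Fin (n + 1)) :=
  (finSuccEquiv n).trans ((Equiv.optionCongr σ).trans finSuccEquivLast.symm)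

/-- Prepend the two new largest values, in increasing order, to the one-line notation of `σ`. -/
def consMaxPair {n : ℕ} (σ : Equiv.Perm (Fin n)) : Equiv.Perm (Fin (n + 2)) :=
  (Equiv.swap 0 1).trans (consMax (consMax σ))

theorem consMax_zero {n : ℕ} (σ : Equiv.Perm (Fin n)) : consMax σ 0 = Fin.last n := by
  simp [consMax]

theorem consMax_succ {n : ℕ} (σ : Equiv.Perm (Fin n)) (i : Fin n) :
    consMax σ i.succ = (σ i).castSucc := by
  simp [consMax]

theorem permVal_consMax_zero {n : ℕ} (σ : Equiv.Perm (Fin n)) : permVal (consMax σ) 0 = n := by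
  simp [permVal, consMax_zero]

theorem permVal_consMax_succ {n : ℕ} (σ : Equiv.Perm (Fin n)) (i : ℕ) :
    permVal (consMax σ) (i + 1) = permVal σ i := by
  by_cases h : i < n
  · have := consMax_succ σ ⟨i, h⟩
    simp only [Fin.succ_mk] at this
    simp [permVal, h, this]
  · simp [permVal, h]

theorem permVal_consMaxPair_zero {n : ℕ} (σ : Equiv.Perm (Fin n)) :
    permVal (consMaxPair σ) 0 = n := by
  have := permVal_consMax_succ (consMax σ) 0
  rw [permVal_consMax_zero] at this
  simpa [permVal, consMaxPair] using this

theorem permVal_consMaxPair_one {n : ℕ} (σ : Equiv.Perm (Fin n)) :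
    permVal (consMaxPair σ) 1 = n + 1 := by
  simp [permVal, consMaxPair, consMax_zero]

theorem permVal_consMaxPair_add_two {n : ℕ} (σ : Equiv.Perm (Fin n)) (i : ℕ) :
    permVal (consMaxPair σ) (i + 2) = permVal σ i := by
  rw [← permVal_consMax_succ σ, ← permVal_consMax_succ (consMax σ)]
  by_cases h : i < n
  · have : Equiv.swap (0 : Fin (n + 2)) 1 ⟨i + 2, by omega⟩ = ⟨i + 2, by omega⟩ :=
      Equiv.swap_apply_of_ne_of_ne (by simp [Fin.ext_iff]) (by simp [Fin.ext_iff])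
    simp [permVal, consMaxPair, h, this]
  · simp [permVal, h]

theorem consMax_injective {n : ℕ} : Function.Injective (consMax (n := n)) := by
  intro σ τ h
  refine perm_ext_of_permVal fun i _ => ?_
  rw [← permVal_consMax_succ, h, permVal_consMax_succ]

theorem consMaxPair_injective {n : ℕ} : Function.Injective (consMaxPair (n := n)) := by
  intro σ τ h
  refine perm_ext_of_permVal fun i _ => ?_
  rw [← permVal_consMaxPair_add_two, h, permVal_consMaxPair_add_two]

theorem exists_consMax_eq {n : ℕ} (τ : Equiv.Perm (Fin (n + 1))) (h : τ 0 = Fin.last n) :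
    ∃ σ, consMax σ = τ := by
  have hne : ∀ i : Fin n, τ i.succ ≠ Fin.last n := fun i e =>
    Fin.succ_ne_zero i (τ.injective (e.trans h.symm))
  have hinj : Function.Injective fun i : Fin n => (τ i.succ).castPred (hne i) := by
    intro i j hij
    simpa using hij
  refine ⟨Equiv.ofBijective _ (Finite.injective_iff_bijective.1 hinj), Equiv.ext fun i => ?_⟩
  refine Fin.cases ?_ (fun i => ?_) i
  · rw [consMax_zero, h]
  · rw [consMax_succ]
    simp

theorem consMax_mem_S123_iff {n : ℕ} (σ : Equiv.Perm (Fin n)) :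
    consMax σ ∈ S123 (n + 1) ↔ σ ∈ S123 n := by
  rw [mem_S123_iff, mem_S123_iff]
  constructor
  · intro h i k hik hk
    simpa [permVal_consMax_succ] using h (i + 1) (k + 1) (by omega) (by omega)
  · intro h i k hik hk
    obtain ⟨k, rfl⟩ : ∃ l, k = l + 1 := ⟨k - 1, by omega⟩
    rw [permVal_consMax_succ]
    cases i with
    | zero => rw [permVal_consMax_zero]; exact permVal_lt σ (by omega)
    | succ i => rw [permVal_consMax_succ]; exact h i k (by omega) (by omega)

theorem consMaxPair_mem_S123_iff {n : ℕ} (σ : Equiv.Perm (Fin n)) :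
    consMaxPair σ ∈ S123 (n + 2) ↔ σ ∈ S123 n := by
  rw [mem_S123_iff, mem_S123_iff]
  constructor
  · intro h i k hik hk
    simpa [permVal_consMaxPair_add_two] using h (i + 2) (k + 2) (by omega) (by omega)
  · intro h i k hik hk
    obtain ⟨k, rfl⟩ : ∃ l, k = l + 2 := ⟨k - 2, by omega⟩
    rw [permVal_consMaxPair_add_two]
    have hlt := permVal_lt σ (i := k) (by omega)
    match i with
    | 0 => rwa [permVal_consMaxPair_zero]
    | 1 => rw [permVal_consMaxPair_one]; omega
    | i + 2 => rw [permVal_consMaxPair_add_two]; exact h i k (by omega) (by omega)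

theorem exists_of_mem_S123 {n : ℕ} {τ : Equiv.Perm (Fin (n + 2))} (h : τ ∈ S123 (n + 2)) :
    (∃ σ ∈ S123 (n + 1), consMax σ = τ) ∨ ∃ σ ∈ S123 n, consMaxPair σ = τ := by
  have hτ := (mem_S123_iff τ).1 h
  have hlt : ∀ k : Fin (n + 2), 2 ≤ (k : ℕ) → τ k < τ 0 := by
    intro k hk
    have := hτ 0 k (by omega) k.isLt
    rw [permVal_coe] at this
    simpa [permVal] using this
  obtain ⟨p, hp⟩ := τ.surjective (Fin.last (n + 1))
  have hp2 : (p : ℕ) < 2 := by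
    by_contra hge
    have := hlt p (by omega)
    rw [hp] at this
    exact absurd (Fin.le_last (τ 0)) (not_le.2 this)
  by_cases hp0 : p = 0
  · subst hp0
    obtain ⟨σ, rfl⟩ := exists_consMax_eq τ hp
    exact Or.inl ⟨σ, (consMax_mem_S123_iff σ).1 h, rfl⟩
  · have hp1 : p = 1 := by
      have : (p : ℕ) ≠ 0 := fun e => hp0 (Fin.ext e)
      ext
      simp
      omega
    subst hp1
    obtain ⟨k, hk⟩ := τ.surjective (Fin.last n).castSucc
    have hk1 : k ≠ 1 := by
      rintro rfl
      rw [hp] at hk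
      simp [Fin.ext_iff] at hk
    have hk0 : k = 0 := by
      by_contra hk0
      have h0 : (k : ℕ) ≠ 0 := fun e => hk0 (Fin.ext e)
      have h1 : (k : ℕ) ≠ 1 := fun e => hk1 (Fin.ext (by simpa using e))
      have h2 := hlt k (by omega)
      have h3 : τ 0 ≠ τ 1 := fun e => by simpa using τ.injective e
      rw [hk, Fin.lt_def] at h2
      rw [hp, Ne, Fin.ext_iff] at h3
      simp at h2 h3
      have := (τ 0).isLt
      omega
    subst hk0
    obtain ⟨ρ, hρ⟩ := exists_consMax_eq ((Equiv.swap 0 1).trans τ) (by simpa using hp)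
    have hρ0 : ρ 0 = Fin.last n := by
      have h1 := consMax_succ ρ 0
      rw [hρ] at h1
      simp [hk] at h1
      exact h1.symm
    obtain ⟨σ, rfl⟩ := exists_consMax_eq ρ hρ0
    have hσ : consMaxPair σ = τ := by
      rw [consMaxPair, hρ]
      ext i
      simp
    subst hσ
    exact Or.inr ⟨σ, (consMaxPair_mem_S123_iff σ).1 h, rfl⟩

theorem ascStat_consMax {n : ℕ} (σ : Equiv.Perm (Fin n)) :
    ascStat (consMax σ) = ascStat σ := by
  cases n with
  | zero => simp [ascStat]
  | succ n =>
    have h0 := permVal_lt σ (Nat.succ_pos n)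
    simp only [ascStat, card_filter, Nat.add_sub_cancel]
    rw [sum_range_succ']
    simp only [permVal_consMax_succ, permVal_consMax_zero]
    rw [if_neg (by omega), add_zero]

theorem ascStat_consMaxPair {n : ℕ} (σ : Equiv.Perm (Fin n)) :
    ascStat (consMaxPair σ) = ascStat σ + 1 := by
  have hone : permVal (consMaxPair σ) (0 + 1) = n + 1 := permVal_consMaxPair_one σ
  cases n with
  | zero => simp [ascStat, filter_singleton, permVal_consMaxPair_one, permVal_consMaxPair_zero]
  | succ n =>
    have h0 := permVal_lt σ (Nat.succ_pos n)
    simp only [ascStat, card_filter, Nat.add_sub_cancel, show n + 1 + 2 - 1 = n + 1 + 1 by omega]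
    rw [sum_range_succ', sum_range_succ']
    simp only [permVal_consMaxPair_add_two, hone, permVal_consMaxPair_zero, add_assoc,
      Nat.reduceAdd, zero_add]
    rw [if_neg (by omega), if_pos (by omega), zero_add]

theorem invStat_eq_sum {n : ℕ} (σ : Equiv.Perm (Fin n)) :
    invStat σ = ∑ i ∈ range n, ∑ j ∈ range n,
      if i < j ∧ permVal σ j < permVal σ i then 1 else 0 := by
  rw [invStat, card_filter, sum_product]

theorem sum_range_permVal_lt {n m : ℕ} (σ : Equiv.Perm (Fin n)) (h : n ≤ m) :
    (∑ j ∈ range n, if permVal σ j < m then 1 else 0) = n := by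
  rw [sum_congr rfl fun j hj =>
    if_pos ((permVal_lt σ (mem_range.1 hj)).trans_le h)]
  simp

theorem invStat_consMax {n : ℕ} (σ : Equiv.Perm (Fin n)) :
    invStat (consMax σ) = invStat σ + n := by
  simp [invStat_eq_sum, sum_range_succ', permVal_consMax_succ, permVal_consMax_zero,
    sum_range_permVal_lt, -sum_boole]

theorem invStat_consMaxPair {n : ℕ} (σ : Equiv.Perm (Fin n)) :
    invStat (consMaxPair σ) = invStat σ + 2 * n := by
  simp [invStat_eq_sum, sum_range_succ', permVal_consMaxPair_add_two, permVal_consMaxPair_zero,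
    permVal_consMaxPair_one, sum_range_permVal_lt, -sum_boole, -Order.lt_add_one_iff]
  omega

theorem two_mul_ascStat_le : ∀ {n : ℕ} {σ : Equiv.Perm (Fin n)}, σ ∈ S123 n → 2 * ascStat σ ≤ n
  | 0, σ, _ => by simp [ascStat]
  | 1, σ, _ => by simp [ascStat]
  | n + 2, σ, h => by
    obtain ⟨ρ, hρ, rfl⟩ | ⟨ρ, hρ, rfl⟩ := exists_of_mem_S123 h
    · have := two_mul_ascStat_le hρ
      rw [ascStat_consMax]
      omega
    · have := two_mul_ascStat_le hρ
      rw [ascStat_consMaxPair]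
      omega

theorem S123_add_two (n : ℕ) :
    S123 (n + 2) = (S123 (n + 1)).image consMax ∪ (S123 n).image consMaxPair := by
  ext τ
  simp only [mem_union, mem_image]
  refine ⟨exists_of_mem_S123, ?_⟩
  rintro (⟨σ, hσ, rfl⟩ | ⟨σ, hσ, rfl⟩)
  · exact (consMax_mem_S123_iff σ).2 hσ
  · exact (consMaxPair_mem_S123_iff σ).2 hσ

theorem FI_zero : FI 0 = 1 := by
  have h : S123 0 = univ := by
    ext σ
    simp only [mem_S123_iff, mem_univ, iff_true]
    omega
  simp [FI, h, ascStat, invStat]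

theorem FI_one : FI 1 = X 0 := by
  have h : S123 1 = univ := by
    ext σ
    simp only [mem_S123_iff, mem_univ, iff_true]
    omega
  simp [FI, h, ascStat, invStat, filter_singleton]

theorem FI_add_two (n : ℕ) :
    FI (n + 2) = X 0 * X 2 ^ (n + 1) * FI (n + 1) + X 1 * X 2 ^ (2 * n) * FI n := by
  have hdisj : Disjoint ((S123 (n + 1)).image consMax) ((S123 n).image consMaxPair) := by
    simp only [disjoint_left, mem_image, not_exists, not_and]
    rintro _ ⟨σ, -, rfl⟩ ρ - h
    have := congrArg (fun τ => permVal τ 0) h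
    simp [permVal_consMax_zero, permVal_consMaxPair_zero] at this
  rw [FI, S123_add_two, sum_union hdisj, sum_image consMax_injective.injOn,
    sum_image consMaxPair_injective.injOn, FI, FI, mul_sum, mul_sum]
  refine congrArg₂ (· + ·) ?_ ?_
  · refine sum_congr rfl fun σ hσ => ?_
    have := two_mul_ascStat_le hσ
    rw [ascStat_consMax, invStat_consMax,
      show n + 2 - 2 * ascStat σ = n + 1 - 2 * ascStat σ + 1 by omega]
    ring
  · refine sum_congr rfl fun σ _ => ?_
    rw [ascStat_consMaxPair, invStat_consMaxPair,
      show n + 2 - 2 * (ascStat σ + 1) = n - 2 * ascStat σ by omega]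
    ring

/-- Cassini-like identity: for `n ≥ 1`,
`q (Fₙᴵ)² - F_{n+1}ᴵ F_{n-1}ᴵ = (-1)ⁿ yⁿ q^((n-1)²)` in `ℤ[x,y,q]`. -/
theorem stmt13 (n : ℕ) (hn : 1 ≤ n) :
    X 2 * FI n ^ 2 - FI (n + 1) * FI (n - 1) =
      (-1) ^ n * X 1 ^ n * X 2 ^ ((n - 1) ^ 2) := by
  obtain ⟨n, rfl⟩ : ∃ m, n = m + 1 := ⟨n - 1, by omega⟩
  simp only [Nat.add_sub_cancel]
  clear hn
  induction n with
  | zero =>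
    rw [FI_add_two 0, zero_add, FI_one, FI_zero]
    ring
  | succ n ih =>
    have hrec : X 2 * FI (n + 2) ^ 2 - FI (n + 3) * FI (n + 1) =
        -(X 1 * X 2 ^ (2 * n + 1)) * (X 2 * FI (n + 1) ^ 2 - FI (n + 2) * FI n) := by
      rw [FI_add_two (n + 1)]
      nth_rewrite 1 [pow_two]
      nth_rewrite 2 [FI_add_two n]
      ring
    rw [show n + 1 + 1 + 1 = n + 3 from rfl, show n + 1 + 1 = n + 2 from rfl, hrec, ih]
    ring
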